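/- Let f : ℝⁿ → ℝⁿ, G : ℝⁿ → ℝ^{n×m}, Φ : ℝⁿ → ℝ^{m×p} be continuous, h : ℝⁿ → ℝ continuously differentiable, θ ∈ ℝᵖ, and Γ ∈ ℝ^{p×p} symmetric positive definite. Define ψ(x) := (∇h(x)ᵀ G(x) Φ(x))ᵀ and h_a(x, θ̂) := h(x) − ½ (θ − θ̂)ᵀ Γ⁻¹ (θ − θ̂). Let T ∈ (0, ∞] and let x : [0, T) → ℝⁿ, θ̂ : [0, T) → ℝᵖ, u : [0, T) → ℝᵐ be such that x, θ̂ are differentiable with x′(t) = f(x(t)) + G(x(t))(u(t) + Φ(x(t)) θ) and θ̂′(t) = −Γ ψ(x(t)), and suppose the aCBF condition ∇h(x(t)) ⋅ ( f(x(t)) + G(x(t))(u(t) + Φ(x(t)) θ̂(t)) ) ≥ 0 holds for all t ∈ [0, T). Then t ↦ h_a(x(t), θ̂(t)) is nondecreasing on [0, T); in particular, if h_a(x(0), θ̂(0)) ≥ 0, then h_a(x(t), θ̂(t)) ≥ 0 and h(x(t)) ≥ 0 for all t ∈ [0, T). -/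

import Mathlib

open Matrix

/-- `ψ(x) := (∇h(x)ᵀ G(x) Φ(x))ᵀ ∈ ℝᵖ`. -/
noncomputable def psi {n m p : ℕ} (h : (Fin n → ℝ) → ℝ)
    (G : (Fin n → ℝ) → Matrix (Fin n) (Fin m) ℝ)
    (Φ : (Fin n → ℝ) → Matrix (Fin m) (Fin p) ℝ)
    (x : Fin n → ℝ) : Fin p → ℝ :=
  fun j => fderiv ℝ h x (fun i => (G x * Φ x) i j)

/-- Augmented barrier candidate `h_a(x, θ̂) := h(x) - ½ (θ - θ̂)ᵀ Γ⁻¹ (θ - θ̂)`. -/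
noncomputable def hA {n p : ℕ} (h : (Fin n → ℝ) → ℝ) (θ : Fin p → ℝ)
    (Γ : Matrix (Fin p) (Fin p) ℝ) (x : Fin n → ℝ) (θhat : Fin p → ℝ) : ℝ :=
  h x - (1 / 2) * ((θ - θhat) ⬝ᵥ (Γ⁻¹ *ᵥ (θ - θhat)))

theorem HasDerivAt.matrix_dotProduct {ι : Type*} [Fintype ι] {v w : ℝ → ι → ℝ} {v' w' : ι → ℝ}
    {t : ℝ} (hv : HasDerivAt v v' t) (hw : HasDerivAt w w' t) :
    HasDerivAt (fun s => v s ⬝ᵥ w s) (v' ⬝ᵥ w t + v t ⬝ᵥ w') t := by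
  simp only [dotProduct, ← Finset.sum_add_distrib]
  exact HasDerivAt.fun_sum fun i _ => (hasDerivAt_pi.1 hv i).mul (hasDerivAt_pi.1 hw i)

theorem HasDerivAt.matrix_mulVec {ι κ : Type*} [Fintype ι] [Fintype κ] (A : Matrix κ ι ℝ)
    {v : ℝ → ι → ℝ} {v' : ι → ℝ} {t : ℝ} (hv : HasDerivAt v v' t) :
    HasDerivAt (fun s => A *ᵥ v s) (A *ᵥ v') t :=
  (A.mulVecLin.toContinuousLinearMap.hasFDerivAt.comp_hasDerivAt t hv :)

theorem psi_dotProduct {n m p : ℕ} (h : (Fin n → ℝ) → ℝ)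
    (G : (Fin n → ℝ) → Matrix (Fin n) (Fin m) ℝ)
    (Φ : (Fin n → ℝ) → Matrix (Fin m) (Fin p) ℝ) (x : Fin n → ℝ) (v : Fin p → ℝ) :
    psi h G Φ x ⬝ᵥ v = fderiv ℝ h x (G x *ᵥ (Φ x *ᵥ v)) := by
  have key : G x *ᵥ (Φ x *ᵥ v) = ∑ j, v j • fun i => (G x * Φ x) i j := by
    ext i
    rw [mulVec_mulVec]
    simp only [mulVec, dotProduct, Finset.sum_apply, Pi.smul_apply, smul_eq_mul, mul_comm]
  rw [key, map_sum]
  simp [psi, dotProduct, mul_comm]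

/-- Along the update law, the parameter mismatch cancels in the derivative of `hA`. -/
theorem hasDerivAt_hA {n m p : ℕ} {h : (Fin n → ℝ) → ℝ} (hh : Differentiable ℝ h)
    {G : (Fin n → ℝ) → Matrix (Fin n) (Fin m) ℝ} {Φ : (Fin n → ℝ) → Matrix (Fin m) (Fin p) ℝ}
    {θ : Fin p → ℝ} {Γ : Matrix (Fin p) (Fin p) ℝ} (hΓ : Γ.PosDef)
    {x : ℝ → Fin n → ℝ} {θhat : ℝ → Fin p → ℝ} {a : Fin n → ℝ} {b : Fin m → ℝ} {t : ℝ}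
    (hx : HasDerivAt x (a + G (x t) *ᵥ (b + Φ (x t) *ᵥ θ)) t)
    (hθhat : HasDerivAt θhat (-(Γ *ᵥ psi h G Φ (x t))) t) :
    HasDerivAt (fun s => hA h θ Γ (x s) (θhat s))
      (fderiv ℝ h (x t) (a + G (x t) *ᵥ (b + Φ (x t) *ᵥ θhat t))) t := by
  have hv := hθhat.const_sub θ
  rw [neg_neg] at hv
  have hq := hv.matrix_dotProduct (hv.matrix_mulVec Γ⁻¹)
  have hd := ((hh (x t)).hasFDerivAt.comp_hasDerivAt t hx).sub (hq.const_mul (1 / 2))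
  have hdet : IsUnit Γ.det := (Matrix.isUnit_iff_isUnit_det Γ).1 hΓ.isUnit
  have hsymm : Γᵀ = Γ := by simpa [IsHermitian] using hΓ.isHermitian
  have hsum := psi_dotProduct h G Φ (x t) (θ - θhat t)
  have h₁ : (Γ *ᵥ psi h G Φ (x t)) ⬝ᵥ (Γ⁻¹ *ᵥ (θ - θhat t)) =
      psi h G Φ (x t) ⬝ᵥ (θ - θhat t) := by
    rw [← vecMul_transpose, hsymm, ← dotProduct_mulVec, mulVec_mulVec, mul_nonsing_inv _ hdet,
      one_mulVec]
  have h₂ : (θ - θhat t) ⬝ᵥ (Γ⁻¹ *ᵥ (Γ *ᵥ psi h G Φ (x t))) =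
      psi h G Φ (x t) ⬝ᵥ (θ - θhat t) := by
    rw [mulVec_mulVec, nonsing_inv_mul _ hdet, one_mulVec, dotProduct_comm]
  refine hd.congr_deriv ?_
  rw [h₁, h₂, hsum]
  simp only [mulVec_add, mulVec_sub, map_add, map_sub]
  ring

theorem hA_le {n p : ℕ} (h : (Fin n → ℝ) → ℝ) (θ : Fin p → ℝ)
    {Γ : Matrix (Fin p) (Fin p) ℝ} (hΓ : Γ.PosDef) (x : Fin n → ℝ) (θhat : Fin p → ℝ) :
    hA h θ Γ x θhat ≤ h x := by
  have hq := hΓ.inv.posSemidef.dotProduct_mulVec_nonneg (θ - θhat)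
  rw [star_trivial] at hq
  unfold hA
  linarith

/-- aCBF invariance: under the update law `θ̂' = -Γ ψ(x)` and the aCBF
condition `∇h(x) ⋅ (f(x) + G(x)(u + Φ(x) θ̂)) ≥ 0`, the augmented barrier candidate is
nondecreasing along trajectories; in particular if it starts nonnegative it stays
nonnegative, and `h (x t) ≥ 0`. -/
theorem stmt_3 {n m p : ℕ}
    (f : (Fin n → ℝ) → (Fin n → ℝ))
    (G : (Fin n → ℝ) → Matrix (Fin n) (Fin m) ℝ)
    (Φ : (Fin n → ℝ) → Matrix (Fin m) (Fin p) ℝ)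
    (hf : Continuous f) (hG : Continuous G) (hΦ : Continuous Φ)
    (h : (Fin n → ℝ) → ℝ) (hh : ContDiff ℝ 1 h)
    (θ : Fin p → ℝ) (Γ : Matrix (Fin p) (Fin p) ℝ) (hΓ : Γ.PosDef)
    (T : EReal) (hT : 0 < T)
    (x : ℝ → Fin n → ℝ) (θhat : ℝ → Fin p → ℝ) (u : ℝ → Fin m → ℝ)
    (hx : ∀ t : ℝ, 0 ≤ t → (t : EReal) < T →
      HasDerivAt x (f (x t) + G (x t) *ᵥ (u t + Φ (x t) *ᵥ θ)) t)
    (hθhat : ∀ t : ℝ, 0 ≤ t → (t : EReal) < T →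
      HasDerivAt θhat (-(Γ *ᵥ psi h G Φ (x t))) t)
    (hacbf : ∀ t : ℝ, 0 ≤ t → (t : EReal) < T →
      fderiv ℝ h (x t) (f (x t) + G (x t) *ᵥ (u t + Φ (x t) *ᵥ θhat t)) ≥ 0) :
    MonotoneOn (fun t => hA h θ Γ (x t) (θhat t)) {t : ℝ | 0 ≤ t ∧ (t : EReal) < T} ∧
    (hA h θ Γ (x 0) (θhat 0) ≥ 0 →
      ∀ t : ℝ, 0 ≤ t → (t : EReal) < T →
        hA h θ Γ (x t) (θhat t) ≥ 0 ∧ h (x t) ≥ 0) := by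
  have hd : ∀ t ∈ {t : ℝ | 0 ≤ t ∧ (t : EReal) < T},
      HasDerivAt (fun s => hA h θ Γ (x s) (θhat s))
        (fderiv ℝ h (x t) (f (x t) + G (x t) *ᵥ (u t + Φ (x t) *ᵥ θhat t))) t := fun t ht =>
    hasDerivAt_hA (hh.differentiable one_ne_zero) hΓ (hx t ht.1 ht.2) (hθhat t ht.1 ht.2)
  have hconv : Convex ℝ {t : ℝ | 0 ≤ t ∧ (t : EReal) < T} :=
    Set.OrdConnected.convex ⟨fun a ha b hb c hc =>
      ⟨ha.1.trans hc.1, (EReal.coe_le_coe_iff.2 hc.2).trans_lt hb.2⟩⟩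
  have hmono : MonotoneOn (fun t => hA h θ Γ (x t) (θhat t))
      {t : ℝ | 0 ≤ t ∧ (t : EReal) < T} :=
    monotoneOn_of_hasDerivWithinAt_nonneg hconv
      (fun t ht => (hd t ht).continuousAt.continuousWithinAt)
      (fun t ht => (hd t (interior_subset ht)).hasDerivWithinAt)
      (fun t ht => hacbf t (interior_subset ht).1 (interior_subset ht).2)
  refine ⟨hmono, fun h₀ t ht htT => ?_⟩
  have hAt : 0 ≤ hA h θ Γ (x t) (θhat t) :=
    le_trans h₀ (hmono ⟨le_rfl, by simpa using hT⟩ ⟨ht, htT⟩ ht)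
  exact ⟨hAt, hAt.trans (hA_le h θ hΓ (x t) (θhat t))⟩
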